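/- Let γ > 0 and let L : ℝ^m → ℝ be continuous and nonnegative. Then F is twice differentiable on ℝ^m and for all indices i, j, the second partial derivatives satisfy ∂²F/∂θ_j∂θ_i (θ) = −γδ_{ij} + γ²·(E_{p_θ}[θ'_i θ'_j] − E_{p_θ}[θ'_i]·E_{p_θ}[θ'_j]); equivalently, the Hessian of the EntropySGD objective is −∇²F(θ) = γI − γ²Σ_θ, where Σ_θ is the covariance matrix of the density p_θ. -/

import Mathlib

open MeasureTheory

/-- The EntropySGD normalization `Z(θ) = ∫ exp(−L(θ') − (γ/2)‖θ−θ'‖²) dθ'`. -/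
noncomputable def entropyZ (m : ℕ) (γ : ℝ) (L : EuclideanSpace ℝ (Fin m) → ℝ)
    (θ : EuclideanSpace ℝ (Fin m)) : ℝ :=
  ∫ θ' : EuclideanSpace ℝ (Fin m), Real.exp (-L θ' - γ / 2 * ‖θ - θ'‖ ^ 2)

/-- The local-entropy objective `F(θ) = log Z(θ)`. -/
noncomputable def entropyF (m : ℕ) (γ : ℝ) (L : EuclideanSpace ℝ (Fin m) → ℝ)
    (θ : EuclideanSpace ℝ (Fin m)) : ℝ :=
  Real.log (entropyZ m γ L θ)

/-- The probability density `p_θ(θ') = exp(−L(θ') − (γ/2)‖θ−θ'‖²)/Z(θ)`. -/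
noncomputable def entropyPdf (m : ℕ) (γ : ℝ) (L : EuclideanSpace ℝ (Fin m) → ℝ)
    (θ θ' : EuclideanSpace ℝ (Fin m)) : ℝ :=
  Real.exp (-L θ' - γ / 2 * ‖θ - θ'‖ ^ 2) / entropyZ m γ L θ

/-- The mean `μ(θ) = ∫ θ' p_θ(θ') dθ'` of the density `p_θ`. -/
noncomputable def entropyMean (m : ℕ) (γ : ℝ) (L : EuclideanSpace ℝ (Fin m) → ℝ)
    (θ : EuclideanSpace ℝ (Fin m)) : EuclideanSpace ℝ (Fin m) :=
  ∫ θ' : EuclideanSpace ℝ (Fin m), entropyPdf m γ L θ θ' • θ'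

/-- The covariance matrix `(Σ_θ)_{ij} = E_{p_θ}[θ'_i θ'_j] − μ_i(θ)μ_j(θ)`. -/
noncomputable def entropyCov (m : ℕ) (γ : ℝ) (L : EuclideanSpace ℝ (Fin m) → ℝ)
    (θ : EuclideanSpace ℝ (Fin m)) : Matrix (Fin m) (Fin m) ℝ :=
  Matrix.of fun i j =>
    (∫ θ' : EuclideanSpace ℝ (Fin m), θ' i * θ' j * entropyPdf m γ L θ θ') -
      entropyMean m γ L θ i * entropyMean m γ L θ j

lemma norm_le_exp_one_mul_norm {E : Type*} [NormedAddCommGroup E] (x : E) :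
    ‖x‖ ≤ Real.exp (1 * ‖x‖) := by
  linarith [Real.add_one_le_exp (1 * ‖x‖)]

lemma norm_mul_exp_le {E : Type*} [NormedAddCommGroup E] (c : ℝ) (x : E) :
    ‖x‖ * Real.exp (c * ‖x‖) ≤ Real.exp ((c + 1) * ‖x‖) := by
  rw [add_mul, one_mul, add_comm, Real.exp_add]
  gcongr
  linarith [Real.add_one_le_exp ‖x‖]

section TiltedWeight

variable {E G : Type*} [NormedAddCommGroup E] [InnerProductSpace ℝ E]
  [NormedAddCommGroup G] [NormedSpace ℝ G]

/-- The unnormalized density `exp(−L(x) − (γ/2)‖x‖² + γ⟪θ, x⟫)`, which is proportional (with a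
factor depending only on `θ`) to `exp(−L(x) − (γ/2)‖θ−x‖²)`. -/
noncomputable def tiltedWeight (γ : ℝ) (L : E → ℝ) (θ x : E) : ℝ :=
  Real.exp (-L x - γ / 2 * ‖x‖ ^ 2 + γ * inner ℝ θ x)

lemma continuous_tiltedWeight {γ : ℝ} {L : E → ℝ} (hL : Continuous L) (θ : E) :
    Continuous (tiltedWeight γ L θ) := by
  unfold tiltedWeight
  fun_prop

lemma tiltedWeight_pos (γ : ℝ) (L : E → ℝ) (θ x : E) : 0 < tiltedWeight γ L θ x :=
  Real.exp_pos _

lemma exp_neg_sub_norm_sub_sq (γ : ℝ) (L : E → ℝ) (θ x : E) :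
    Real.exp (-L x - γ / 2 * ‖θ - x‖ ^ 2) =
      Real.exp (-(γ / 2 * ‖θ‖ ^ 2)) * tiltedWeight γ L θ x := by
  rw [tiltedWeight, ← Real.exp_add, norm_sub_sq_real]
  ring_nf

/-- A Gaussian bound on the weight, uniform for `θ` in a ball. -/
lemma tiltedWeight_mul_exp_le {γ : ℝ} (hγ : 0 < γ) {L : E → ℝ} (hL : ∀ x, 0 ≤ L x)
    {θ : E} {R : ℝ} (hθ : ‖θ‖ ≤ R) (c : ℝ) (x : E) :
    tiltedWeight γ L θ x * Real.exp (c * ‖x‖) ≤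
      Real.exp ((γ * R + c) ^ 2 / γ) * Real.exp (-(γ / 4) * ‖x‖ ^ 2) := by
  rw [tiltedWeight, ← Real.exp_add, ← Real.exp_add, Real.exp_le_exp]
  have hinner : inner ℝ θ x ≤ R * ‖x‖ :=
    (real_inner_le_norm θ x).trans (by gcongr)
  have hlin : γ * inner ℝ θ x ≤ γ * (R * ‖x‖) := by gcongr
  have hsq : (γ * R + c) * ‖x‖ ≤ (γ * R + c) ^ 2 / γ + γ / 4 * ‖x‖ ^ 2 := by
    have h : (γ * R + c) ^ 2 / γ + γ / 4 * ‖x‖ ^ 2 - (γ * R + c) * ‖x‖ =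
        ((γ * R + c) - γ / 2 * ‖x‖) ^ 2 / γ := by
      field_simp
      ring
    have : 0 ≤ ((γ * R + c) - γ / 2 * ‖x‖) ^ 2 / γ := by positivity
    linarith
  linarith [hL x]

lemma hasFDerivAt_tiltedWeight (γ : ℝ) (L : E → ℝ) (θ x : E) :
    HasFDerivAt (fun θ => tiltedWeight γ L θ x)
      (tiltedWeight γ L θ x • γ • innerSL ℝ x) θ := by
  have h : HasFDerivAt (fun θ : E => -L x - γ / 2 * ‖x‖ ^ 2 + γ * inner ℝ x θ)
      (γ • innerSL ℝ x) θ :=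
    ((innerSL ℝ x).hasFDerivAt.const_mul γ).const_add _
  simpa only [tiltedWeight, real_inner_comm] using h.exp

variable [FiniteDimensional ℝ E] [MeasurableSpace E] [BorelSpace E]

lemma integrable_exp_neg_mul_norm_sq {b : ℝ} (hb : 0 < b) :
    Integrable fun x : E => Real.exp (-b * ‖x‖ ^ 2) := by
  have h := (GaussianFourier.integrable_cexp_neg_mul_sq_norm_add (b := (b : ℂ))
    (by simpa using hb) 0 (0 : E)).norm
  refine h.congr (.of_forall fun x => ?_)
  simp [Complex.norm_exp, ← Complex.ofReal_pow, ← Complex.ofReal_mul]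

lemma integrable_tiltedWeight_smul {γ : ℝ} (hγ : 0 < γ) {L : E → ℝ} (hLc : Continuous L)
    (hL : ∀ x, 0 ≤ L x) {g : E → G} (hg : Continuous g) {c : ℝ}
    (hgc : ∀ x, ‖g x‖ ≤ Real.exp (c * ‖x‖)) (θ : E) :
    Integrable fun x => tiltedWeight γ L θ x • g x := by
  refine ((integrable_exp_neg_mul_norm_sq (E := E) (b := γ / 4) (by positivity)).const_mul
    (Real.exp ((γ * ‖θ‖ + c) ^ 2 / γ))).mono'
    ((continuous_tiltedWeight hLc θ).smul hg).aestronglyMeasurable (.of_forall fun x => ?_)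
  rw [norm_smul, Real.norm_of_nonneg (tiltedWeight_pos γ L θ x).le]
  refine le_trans ?_ (tiltedWeight_mul_exp_le hγ hL le_rfl c x)
  exact mul_le_mul_of_nonneg_left (hgc x) (tiltedWeight_pos γ L θ x).le

/-- Differentiation under the integral sign for tilted integrals of functions of at most
exponential growth. -/
lemma exists_hasFDerivAt_integral_tiltedWeight_smul [CompleteSpace G] {γ : ℝ} (hγ : 0 < γ)
    {L : E → ℝ} (hLc : Continuous L) (hL : ∀ x, 0 ≤ L x) {g : E → G} (hg : Continuous g) {c : ℝ}
    (hgc : ∀ x, ‖g x‖ ≤ Real.exp (c * ‖x‖)) (θ : E) :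
    ∃ D : E →L[ℝ] G, HasFDerivAt (fun θ => ∫ x, tiltedWeight γ L θ x • g x) D θ ∧
      ∀ v, D v = γ • ∫ x, tiltedWeight γ L θ x • inner ℝ x v • g x := by
  set D' : E → E → E →L[ℝ] G := fun θ x =>
    (tiltedWeight γ L θ x • γ • innerSL ℝ x).smulRight (g x) with hD'
  have hcont : Continuous (D' θ) := by
    have := continuous_tiltedWeight (γ := γ) hLc θ
    have h1 : Continuous fun x : E => tiltedWeight γ L θ x • γ • innerSL ℝ x := by fun_prop
    exact (ContinuousLinearMap.smulRightL ℝ E G).continuous₂.comp (h1.prodMk hg)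
  have hbound : ∀ x, ∀ θ' ∈ Metric.ball θ 1, ‖D' θ' x‖ ≤
      γ * (Real.exp ((γ * (‖θ‖ + 1) + (c + 1)) ^ 2 / γ) *
        Real.exp (-(γ / 4) * ‖x‖ ^ 2)) := by
    intro x θ' hθ'
    have hR : ‖θ'‖ ≤ ‖θ‖ + 1 := by
      have := norm_le_norm_add_norm_sub' θ' θ
      rw [mem_ball_iff_norm] at hθ'
      linarith
    have hw := (tiltedWeight_pos γ L θ' x).le
    calc ‖D' θ' x‖ = γ * (tiltedWeight γ L θ' x * (‖x‖ * ‖g x‖)) := by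
          simp only [hD', ContinuousLinearMap.norm_smulRight_apply, norm_smul, innerSL_apply_norm,
            Real.norm_of_nonneg hw, Real.norm_of_nonneg hγ.le]
          ring
      _ ≤ γ * (tiltedWeight γ L θ' x * (‖x‖ * Real.exp (c * ‖x‖))) := by
          gcongr
          exact hgc x
      _ ≤ γ * (tiltedWeight γ L θ' x * Real.exp ((c + 1) * ‖x‖)) := by
          gcongr
          exact norm_mul_exp_le c x
      _ ≤ _ := by
          refine mul_le_mul_of_nonneg_left ?_ hγ.le
          exact tiltedWeight_mul_exp_le hγ hL hR (c + 1) x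
  have hbi : Integrable fun x : E =>
      γ * (Real.exp ((γ * (‖θ‖ + 1) + (c + 1)) ^ 2 / γ) * Real.exp (-(γ / 4) * ‖x‖ ^ 2)) :=
    ((integrable_exp_neg_mul_norm_sq (by positivity)).const_mul _).const_mul _
  have hint : Integrable (D' θ) :=
    hbi.mono' hcont.aestronglyMeasurable
      (.of_forall fun x => hbound x θ (Metric.mem_ball_self one_pos))
  refine ⟨∫ x, D' θ x, ?_, fun v => ?_⟩
  · exact hasFDerivAt_integral_of_dominated_of_fderiv_le (Metric.ball_mem_nhds θ one_pos)
      (.of_forall fun θ' => ((continuous_tiltedWeight hLc θ').smul hg).aestronglyMeasurable)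
      (integrable_tiltedWeight_smul hγ hLc hL hg hgc θ) hcont.aestronglyMeasurable
      (.of_forall hbound) hbi
      (.of_forall fun x θ' _ => (hasFDerivAt_tiltedWeight γ L θ' x).smul_const (g x))
  · rw [ContinuousLinearMap.integral_apply hint, ← integral_smul]
    refine integral_congr_ae (.of_forall fun x => ?_)
    simp only [hD', ContinuousLinearMap.smulRight_apply, smul_apply,
      innerSL_apply_apply, smul_smul, smul_eq_mul]
    ring_nf

end TiltedWeight

section Entropy

variable {m : ℕ} {γ : ℝ} {L : EuclideanSpace ℝ (Fin m) → ℝ}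

lemma integral_tiltedWeight_pos (hγ : 0 < γ) (hLc : Continuous L) (hL : ∀ x, 0 ≤ L x)
    (θ : EuclideanSpace ℝ (Fin m)) : 0 < ∫ x, tiltedWeight γ L θ x := by
  refine integral_exp_pos ?_
  simpa [tiltedWeight] using integrable_tiltedWeight_smul hγ hLc hL
    (g := fun _ => (1 : ℝ)) (c := 0) continuous_const (by simp) θ

lemma entropyZ_eq (θ : EuclideanSpace ℝ (Fin m)) :
    entropyZ m γ L θ = Real.exp (-(γ / 2 * ‖θ‖ ^ 2)) * ∫ x, tiltedWeight γ L θ x := by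
  simp only [entropyZ, exp_neg_sub_norm_sub_sq, integral_const_mul]

lemma entropyPdf_eq (θ x : EuclideanSpace ℝ (Fin m)) :
    entropyPdf m γ L θ x = (∫ x, tiltedWeight γ L θ x)⁻¹ * tiltedWeight γ L θ x := by
  rw [entropyPdf, entropyZ_eq, exp_neg_sub_norm_sub_sq,
    mul_div_mul_left _ _ (Real.exp_pos _).ne', div_eq_inv_mul]

lemma entropyMean_eq (θ : EuclideanSpace ℝ (Fin m)) :
    entropyMean m γ L θ = (∫ x, tiltedWeight γ L θ x)⁻¹ • ∫ x, tiltedWeight γ L θ x • x := by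
  simp only [entropyMean, entropyPdf_eq, mul_smul, integral_smul]

lemma hasFDerivAt_integral_tiltedWeight (hγ : 0 < γ) (hLc : Continuous L) (hL : ∀ x, 0 ≤ L x)
    (θ : EuclideanSpace ℝ (Fin m)) :
    HasFDerivAt (fun θ => ∫ x, tiltedWeight γ L θ x)
      (γ • innerSL ℝ (∫ x, tiltedWeight γ L θ x • x)) θ := by
  obtain ⟨D, hD, hDv⟩ := exists_hasFDerivAt_integral_tiltedWeight_smul hγ hLc hL
    (g := fun _ => (1 : ℝ)) (c := 0) continuous_const (by simp) θ
  simp only [smul_eq_mul, mul_one] at hD hDv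
  refine hD.congr_fderiv (ContinuousLinearMap.ext fun v => ?_)
  rw [hDv]
  have hint := integrable_tiltedWeight_smul hγ hLc hL (g := fun x => x) continuous_id
    (norm_le_exp_one_mul_norm (E := EuclideanSpace ℝ (Fin m))) θ
  simp only [smul_apply, innerSL_apply_apply, smul_eq_mul]
  rw [real_inner_comm, ← integral_inner hint]
  simp [real_inner_smul_right, real_inner_comm]

lemma gradient_entropyF (hγ : 0 < γ) (hLc : Continuous L) (hL : ∀ x, 0 ≤ L x) :
    gradient (entropyF m γ L) = fun θ => (-γ) • θ + γ • entropyMean m γ L θ := by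
  funext θ
  refine HasGradientAt.gradient ?_
  have hF : entropyF m γ L = fun θ =>
      -(γ / 2 * ‖θ‖ ^ 2) + Real.log (∫ x, tiltedWeight γ L θ x) := by
    funext θ
    rw [entropyF, entropyZ_eq, Real.log_mul (Real.exp_pos _).ne'
      (integral_tiltedWeight_pos hγ hLc hL θ).ne', Real.log_exp]
  rw [hasGradientAt_iff_hasFDerivAt, hF]
  refine ((((hasStrictFDerivAt_norm_sq θ).hasFDerivAt.const_mul (γ / 2)).neg).add
    ((hasFDerivAt_integral_tiltedWeight hγ hLc hL θ).log
      (integral_tiltedWeight_pos hγ hLc hL θ).ne')).congr_fderiv (ContinuousLinearMap.ext fun v => ?_)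
  simp [entropyMean_eq]
  ring

lemma integral_tiltedWeight_smul_apply (hγ : 0 < γ) (hLc : Continuous L) (hL : ∀ x, 0 ≤ L x)
    (θ : EuclideanSpace ℝ (Fin m)) {g : EuclideanSpace ℝ (Fin m) → EuclideanSpace ℝ (Fin m)}
    (hg : Continuous g) {c : ℝ} (hgc : ∀ x, ‖g x‖ ≤ Real.exp (c * ‖x‖)) (i : Fin m) :
    (∫ x, tiltedWeight γ L θ x • g x) i = ∫ x, tiltedWeight γ L θ x * g x i := by
  have h := (EuclideanSpace.proj (𝕜 := ℝ) i).integral_comp_comm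
    (integrable_tiltedWeight_smul hγ hLc hL hg hgc θ)
  simpa using h.symm

lemma hasFDerivAt_entropyMean (hγ : 0 < γ) (hLc : Continuous L) (hL : ∀ x, 0 ≤ L x)
    (θ : EuclideanSpace ℝ (Fin m)) :
    HasFDerivAt (entropyMean m γ L)
      (γ • LinearMap.toContinuousLinearMap (Matrix.toEuclideanLin (entropyCov m γ L θ))) θ := by
  obtain ⟨D, hD, hDv⟩ := exists_hasFDerivAt_integral_tiltedWeight_smul hγ hLc hL (g := fun x => x) continuous_id
    (norm_le_exp_one_mul_norm (E := EuclideanSpace ℝ (Fin m))) θ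
  have hpos := (integral_tiltedWeight_pos hγ hLc hL θ).ne'
  have hinv := (hasDerivAt_inv hpos).comp_hasFDerivAt θ
    (hasFDerivAt_integral_tiltedWeight hγ hLc hL θ)
  rw [show entropyMean m γ L = _ from funext entropyMean_eq]
  refine (hinv.smul hD).congr_fderiv (ContinuousLinearMap.coe_injective
    ((EuclideanSpace.basisFun (Fin m) ℝ).toBasis.ext fun j => ?_))
  ext i
  have hsecond : (∫ x, tiltedWeight γ L θ x • x j • x) i =
      ∫ x, tiltedWeight γ L θ x * (x i * x j) := by
    rw [integral_tiltedWeight_smul_apply hγ hLc hL θ (g := fun x => x j • x) (c := 1 + 1)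
      (by fun_prop) (fun x => ?_) i]
    · simp [mul_comm]
    · rw [norm_smul]
      calc ‖x j‖ * ‖x‖ ≤ ‖x‖ * Real.exp (1 * ‖x‖) :=
            mul_le_mul (PiLp.norm_apply_le x j) (norm_le_exp_one_mul_norm x)
              (norm_nonneg _) (norm_nonneg _)
        _ ≤ _ := norm_mul_exp_le 1 x
  have hcov : ∫ x, x i * x j * entropyPdf m γ L θ x =
      (∫ x, tiltedWeight γ L θ x)⁻¹ * ∫ x, tiltedWeight γ L θ x * (x i * x j) := by
    rw [← integral_const_mul]
    simp only [entropyPdf_eq]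
    congr with x
    ring
  simp [hDv, hsecond, entropyCov, hcov, entropyMean_eq, EuclideanSpace.inner_single_right]
  field_simp
  ring

end Entropy

/-- For `γ > 0` and `L` continuous and nonnegative, `F` is twice
differentiable: the gradient `∇F` has at each `θ` the Fréchet derivative (Hessian)
`∇²F(θ) = −γI + γ²Σ_θ`, i.e. componentwise
`∂²F/∂θ_j∂θ_i = −γδ_{ij} + γ²(E_{p_θ}[θ'_iθ'_j] − E_{p_θ}[θ'_i]E_{p_θ}[θ'_j])`. -/
theorem entropySGD_hessian (m : ℕ) (γ : ℝ) (hγ : 0 < γ)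
    (L : EuclideanSpace ℝ (Fin m) → ℝ) (hLc : Continuous L) (hLnn : ∀ θ', 0 ≤ L θ') :
    ∀ θ : EuclideanSpace ℝ (Fin m),
      HasFDerivAt (gradient (entropyF m γ L))
        ((-γ) • ContinuousLinearMap.id ℝ (EuclideanSpace ℝ (Fin m)) +
          γ ^ 2 • LinearMap.toContinuousLinearMap
            (Matrix.toEuclideanLin (entropyCov m γ L θ))) θ ∧
      ∀ i j : Fin m,
        (fderiv ℝ (gradient (entropyF m γ L)) θ) (EuclideanSpace.single j 1) i =
          -γ * (if i = j then (1 : ℝ) else 0) +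
            γ ^ 2 * ((∫ θ' : EuclideanSpace ℝ (Fin m), θ' i * θ' j * entropyPdf m γ L θ θ') -
              entropyMean m γ L θ i * entropyMean m γ L θ j) := by
  intro θ
  have h : HasFDerivAt (gradient (entropyF m γ L))
      ((-γ) • ContinuousLinearMap.id ℝ (EuclideanSpace ℝ (Fin m)) +
        γ ^ 2 • LinearMap.toContinuousLinearMap
          (Matrix.toEuclideanLin (entropyCov m γ L θ))) θ := by
    rw [gradient_entropyF hγ hLc hLnn, pow_two, mul_smul]
    exact ((hasFDerivAt_id θ).const_smul (-γ)).add
      ((hasFDerivAt_entropyMean hγ hLc hLnn θ).const_smul γ)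
  refine ⟨h, fun i j => ?_⟩
  rw [h.fderiv]
  simp [entropyCov, neg_ite]
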